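/- For every pair of bits q₁, q₅ ∈ {0,1}, every middle string A = (0, A₁, A₀) with A₁, A₀ ∈ {0,1}, every x⃗=(x₁,x₂,x₃) ∈ {0,1}³ of even Hamming weight, every sign s ∈ {+1,−1}, and all bits i,j,k ∈ {0,1} with i+j+k even, the 5-qubit vector v_{A,x⃗,s} satisfies (I ⊗ P_i ⊗ P_j ⊗ P_k ⊗ X) v_{A,x⃗,s} = s · (−1)^{x₁} · (√−1)^{i+j+k} · (−1)^{j A₁ + k A₀} · v_{A,x⃗,s}. (The sign (−1)^{x₁} reproduces exactly the four cases x⃗ = (0,0,0), (1,0,1), (0,1,1), (1,1,0) listed in the paper, with signs +, −, +, − respectively.) -/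

import Mathlib

open Matrix Complex

noncomputable section

/-- Single-qubit Pauli X. -/
def Xg : Matrix (Fin 2) (Fin 2) ℂ := !![0, 1; 1, 0]
/-- Single-qubit Pauli Y. -/
def Yg : Matrix (Fin 2) (Fin 2) ℂ := !![0, -Complex.I; Complex.I, 0]
/-- Single-qubit Pauli Z. -/
def Zg : Matrix (Fin 2) (Fin 2) ℂ := !![1, 0; 0, -1]
/-- P₀ = X, P₁ = Y. -/
def Pg : Fin 2 → Matrix (Fin 2) (Fin 2) ℂ := fun i => if i = 0 then Xg else Yg

/-- Tensor (Kronecker) product of `n` single-qubit operators, as a matrix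
indexed by bit strings. -/
def tens {n : ℕ} (M : Fin n → Matrix (Fin 2) (Fin 2) ℂ) :
    Matrix (Fin n → Fin 2) (Fin n → Fin 2) ℂ :=
  Matrix.of fun r c => ∏ m, M m (r m) (c m)

/-- Computational basis vector |q⟩. -/
def ket {n : ℕ} (q : Fin n → Fin 2) : (Fin n → Fin 2) → ℂ :=
  fun r => if r = q then 1 else 0

/-- The eigenvector v_{A,x⃗,s} of the paper (5 qubits), with A = (0, A₁, A₀). -/
def vAx (q₁ q₅ A₁ A₀ x₁ x₂ x₃ : Fin 2) (s : ℂ) : (Fin 5 → Fin 2) → ℂ :=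
  (ket ![q₁, 0, A₁, A₀, q₅]
    + ((-1 : ℂ) ^ (x₁ : ℕ)) • ket ![q₁, 0, A₁, A₀, q₅+1]
    + ((-1 : ℂ) ^ (x₂ : ℕ)) • ket ![q₁+1, 0, A₁, A₀, q₅]
    + ((-1 : ℂ) ^ (x₃ : ℕ)) • ket ![q₁+1, 0, A₁, A₀, q₅+1])
  + s • (ket ![q₁, 1, A₁+1, A₀+1, q₅]
    + ((-1 : ℂ) ^ (x₁ : ℕ)) • ket ![q₁, 1, A₁+1, A₀+1, q₅+1]
    + ((-1 : ℂ) ^ (x₂ : ℕ)) • ket ![q₁+1, 1, A₁+1, A₀+1, q₅]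
    + ((-1 : ℂ) ^ (x₃ : ℕ)) • ket ![q₁+1, 1, A₁+1, A₀+1, q₅+1])

/-- A tensor product operator sends a basis vector to the tensor product of columns. -/
theorem tens_mulVec_ket {n : ℕ} (M : Fin n → Matrix (Fin 2) (Fin 2) ℂ) (q : Fin n → Fin 2) :
    (tens M).mulVec (ket q) = fun r => ∏ m, M m (r m) (q m) := by
  ext r
  simp [Matrix.mulVec, dotProduct, ket, tens]

/-- `P_i` flips a basis bit, up to the phase `√-1 ^ i * (-1) ^ (i * a)`. -/
theorem Pg_apply (i r a : Fin 2) :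
    Pg i r a = if r = a + 1 then Complex.I ^ (i : ℕ) * (-1) ^ ((i : ℕ) * (a : ℕ)) else 0 := by
  fin_cases i <;> fin_cases r <;> fin_cases a <;> simp [Pg, Xg, Yg]

theorem Xg_apply (r a : Fin 2) : Xg r a = if r = a + 1 then 1 else 0 := by
  fin_cases r <;> fin_cases a <;> simp [Xg]

theorem tens_Pg_mulVec_ket (i j k a b c d e : Fin 2) :
    (tens ![1, Pg i, Pg j, Pg k, Xg]).mulVec (ket ![a, b, c, d, e]) =
      (Complex.I ^ ((i : ℕ) + (j : ℕ) + (k : ℕ)) *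
        (-1 : ℂ) ^ ((i : ℕ) * (b : ℕ) + (j : ℕ) * (c : ℕ) + (k : ℕ) * (d : ℕ))) •
        ket ![a, b + 1, c + 1, d + 1, e + 1] := by
  rw [tens_mulVec_ket]
  ext r
  have h : r = ![a, b + 1, c + 1, d + 1, e + 1] ↔
      r 0 = a ∧ r 1 = b + 1 ∧ r 2 = c + 1 ∧ r 3 = d + 1 ∧ r 4 = e + 1 := by
    simp [funext_iff, Fin.forall_fin_succ]
  simp only [Pi.smul_apply, smul_eq_mul, ket, h, Fin.prod_univ_five, Matrix.cons_val,
    Pg_apply, Xg_apply, Matrix.one_apply]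
  by_cases h0 : r 0 = a <;> by_cases h1 : r 1 = b + 1 <;> by_cases h2 : r 2 = c + 1 <;>
    by_cases h3 : r 3 = d + 1 <;> by_cases h4 : r 4 = e + 1 <;> simp [h0, h1, h2, h3, h4]
  ring

theorem neg_one_pow_mul_bit_add_one (j a : Fin 2) :
    (-1 : ℂ) ^ ((j : ℕ) * ((a + 1 : Fin 2) : ℕ)) = (-1) ^ (j : ℕ) * (-1) ^ ((j : ℕ) * (a : ℕ)) := by
  fin_cases j <;> fin_cases a <;> simp

theorem stmt18 (q₁ q₅ A₁ A₀ x₁ x₂ x₃ : Fin 2)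
    (hx : Even ((x₁ : ℕ) + (x₂ : ℕ) + (x₃ : ℕ)))
    (s : ℂ) (hs : s = 1 ∨ s = -1)
    (i j k : Fin 2) (heven : Even ((i : ℕ) + (j : ℕ) + (k : ℕ))) :
    (tens ![1, Pg i, Pg j, Pg k, Xg]).mulVec (vAx q₁ q₅ A₁ A₀ x₁ x₂ x₃ s) =
      (s * (-1 : ℂ) ^ (x₁ : ℕ) * Complex.I ^ ((i : ℕ) + (j : ℕ) + (k : ℕ)) *
        (-1 : ℂ) ^ ((j : ℕ) * (A₁ : ℕ) + (k : ℕ) * (A₀ : ℕ))) •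
        vAx q₁ q₅ A₁ A₀ x₁ x₂ x₃ s := by
  have hbit : ∀ a : Fin 2, a + 1 + 1 = a := by decide
  have hsq : s * s = 1 := by rcases hs with rfl | rfl <;> norm_num
  have hx1 : (-1 : ℂ) ^ (x₁ : ℕ) * (-1) ^ (x₁ : ℕ) = 1 := by
    rw [← mul_pow]; norm_num
  have hx3 : (-1 : ℂ) ^ (x₃ : ℕ) = (-1) ^ (x₁ : ℕ) * (-1) ^ (x₂ : ℕ) := by
    have h := hx.neg_one_pow (α := ℂ)
    rw [pow_add, pow_add] at h
    have hx33 : (-1 : ℂ) ^ (x₃ : ℕ) * (-1) ^ (x₃ : ℕ) = 1 := by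
      rw [← mul_pow]; norm_num
    linear_combination (-1 : ℂ) ^ (x₁ : ℕ) * (-1) ^ (x₂ : ℕ) * hx33 - (-1) ^ (x₃ : ℕ) * h
  have hpar : (-1 : ℂ) ^ (i : ℕ) * (-1) ^ (j : ℕ) * (-1) ^ (k : ℕ) = 1 := by
    rw [← pow_add, ← pow_add, heven.neg_one_pow]
  have hphase : (-1 : ℂ) ^ ((i : ℕ) * ((1 : Fin 2) : ℕ) + (j : ℕ) * ((A₁ + 1 : Fin 2) : ℕ) +
      (k : ℕ) * ((A₀ + 1 : Fin 2) : ℕ)) = (-1) ^ ((j : ℕ) * (A₁ : ℕ) + (k : ℕ) * (A₀ : ℕ)) := by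
    simp only [pow_add, neg_one_pow_mul_bit_add_one, Fin.val_one, mul_one]
    linear_combination (-1 : ℂ) ^ ((j : ℕ) * (A₁ : ℕ)) * (-1) ^ ((k : ℕ) * (A₀ : ℕ)) * hpar
  have h10 : (1 + 1 : Fin 2) = 0 := rfl
  simp only [vAx, Matrix.mulVec_add, Matrix.mulVec_smul, tens_Pg_mulVec_ket, hphase, hbit, h10,
    zero_add, Fin.val_zero, mul_zero, hx3]
  generalize (-1 : ℂ) ^ (x₁ : ℕ) = u at *
  generalize (-1 : ℂ) ^ (x₂ : ℕ) = v at *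
  generalize Complex.I ^ ((i : ℕ) + (j : ℕ) + (k : ℕ)) = p
  generalize (-1 : ℂ) ^ ((j : ℕ) * (A₁ : ℕ) + (k : ℕ) * (A₀ : ℕ)) = t
  ext r
  simp only [Pi.add_apply, Pi.smul_apply, smul_eq_mul]
  linear_combination
    -(p * t * (u * u * ket ![q₁, 1, A₁ + 1, A₀ + 1, q₅ + 1] r +
      u * ket ![q₁, 1, A₁ + 1, A₀ + 1, q₅] r +
      v * u * u * ket ![q₁ + 1, 1, A₁ + 1, A₀ + 1, q₅ + 1] r +
      u * v * ket ![q₁ + 1, 1, A₁ + 1, A₀ + 1, q₅] r)) * hsq -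
    p * t * (ket ![q₁, 1, A₁ + 1, A₀ + 1, q₅ + 1] r +
      v * ket ![q₁ + 1, 1, A₁ + 1, A₀ + 1, q₅ + 1] r +
      s * ket ![q₁, 0, A₁, A₀, q₅ + 1] r +
      s * v * ket ![q₁ + 1, 0, A₁, A₀, q₅ + 1] r) * hx1
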